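/- arXiv:math/0211083 — 2 statements merged into one kernel-verified Lean document; each statement's English description precedes it below -/
import Mathlib

section
/- Let a be a positive integer which is not a perfect h-th power for any h ≥ 2, write a = a1·a2² with a1 squarefree, and let u be a positive integer. Let a^{1/u} denote the real positive u-th root of a and regard Q(a^{1/u}) as a subfield of the complex numbers. Then the maximal subfield of Q(a^{1/u}) that is normal over Q is: Q itself if u is odd, and Q(√a1) if u is even. In particular, every subfield F of Q(a^{1/u}) with F/Q normal satisfies F = Q when u is odd, and F ⊆ Q(√a1) when u is even (and √a1 ∈ Q(a^{1/u}) when u is even). -/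
open scoped Classical
open IntermediateField

/-- `zet m = ζ_m = exp(2πi/m)`. -/
noncomputable def zet (m : ℕ) : ℂ := Complex.exp (2 * Real.pi * Complex.I / m)

/-- `rootC a u`: the real positive `u`-th root of `a`, regarded as a complex number. -/
noncomputable def rootC (a u : ℕ) : ℂ := (((a : ℝ) ^ ((u : ℝ)⁻¹) : ℝ) : ℂ)

lemma aux_dvd (a u : ℕ) (hu : 0 < u) (hpow : ∀ h, 2 ≤ h → ¬∃ b : ℕ, b ^ h = a)
    (r : ℝ) (hr : 0 < r) (hru : r ^ u = a) (k : ℕ)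
    (hk : (r : ℂ) ^ k ∈ (⊥ : IntermediateField ℚ ℂ)) : u ∣ k := by
  obtain ⟨q, hq⟩ := IntermediateField.mem_bot.mp hk
  have hq' : r ^ k = (q : ℝ) := by
    have : ((r ^ k : ℝ) : ℂ) = ((q : ℝ) : ℂ) := by
      push_cast; rw [← hq]; simp
    exact_mod_cast this
  have hqpos : 0 < q := by
    have : (0 : ℝ) < q := by rw [← hq']; positivity
    exact_mod_cast this
  have h1 : q ^ u = (a : ℚ) ^ k := by
    have : (q : ℝ) ^ u = (a : ℝ) ^ k := by
      rw [← hq', ← hru, ← pow_mul, ← pow_mul, mul_comm]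
    exact_mod_cast this
  have hint : IsIntegral ℤ q := by
    refine IsIntegral.of_pow hu ?_
    rw [h1]
    exact_mod_cast isIntegral_algebraMap (R := ℤ) (A := ℚ) (x := ((a ^ k : ℕ) : ℤ))
  obtain ⟨z, hz⟩ := IsIntegrallyClosed.isIntegral_iff.mp hint
  have hz' : (z : ℚ) = q := by simpa using hz
  have hzpos : 0 < z := by
    rw [← hz'] at hqpos; exact_mod_cast hqpos
  lift z to ℕ using hzpos.le
  have h2 : a ^ k = z ^ u := by
    rw [← hz'] at h1
    exact_mod_cast h1.symm
  obtain ⟨c, hc, -⟩ := Nat.exists_eq_pow_of_pow_eq_pow (Or.inr hu.ne') h2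
  have h3 : u / gcd k u < 2 := by
    by_contra h
    exact hpow _ (not_lt.mp h) ⟨c, hc.symm⟩
  have hg : Nat.gcd k u ∣ u := Nat.gcd_dvd_right k u
  have hg2 : Nat.gcd k u ∣ k := Nat.gcd_dvd_left k u
  obtain ⟨t, ht⟩ := hg
  have hgp : 0 < Nat.gcd k u := Nat.gcd_pos_of_pos_right _ hu
  have h4 : u / Nat.gcd k u = t := Nat.div_eq_of_eq_mul_right hgp ht
  have h3' : t < 2 := by rw [← h4]; exact h3
  have : t ≠ 0 := by rintro rfl; simp at ht; omega
  have : t = 1 := by omega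
  rw [this, mul_one] at ht
  rw [ht]; exact hg2

lemma aux_pow_mem (a u : ℕ) (hu : 0 < u)
    (r : ℝ) (hr : 0 < r) (hru : r ^ u = a) (F : IntermediateField ℚ ℂ)
    (hF : ∀ x ∈ F, ∃ y : ℝ, (y : ℂ) = x) :
    (r : ℂ) ^ (minpoly F (r : ℂ)).natDegree ∈ F := by
  have hruC : (r : ℂ) ^ u = a := by exact_mod_cast hru
  have hint : IsIntegral F (r : ℂ) := by
    refine IsIntegral.of_pow hu ?_
    rw [hruC]
    exact_mod_cast isIntegral_algebraMap (R := F) (A := ℂ) (x := ((a : ℕ) : F))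
  set p := minpoly F (r : ℂ) with hp
  have hmon : p.Monic := minpoly.monic hint
  have hdiv : p ∣ Polynomial.X ^ u - Polynomial.C (a : F) := by
    apply minpoly.dvd
    simp [hruC]
  set P := p.map (algebraMap F ℂ) with hP
  have hPm : P.Monic := hmon.map _
  have hs : P.Splits := IsAlgClosed.splits P
  have hnd : P.natDegree = p.natDegree := Polynomial.natDegree_map _
  have hroot : ∀ x ∈ P.roots, ‖x‖ = r := by
    intro x hx
    have h1 : Polynomial.eval x P = 0 := (Polynomial.mem_roots'.mp hx).2
    have h2 : x ^ u = a := by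
      obtain ⟨g, hg⟩ := hdiv
      have := congrArg (fun f => Polynomial.eval x (f.map (algebraMap F ℂ))) hg
      simp [← hP, h1] at this
      exact sub_eq_zero.mp this
    have h3 : ‖x‖ ^ u = r ^ u := by rw [← norm_pow, h2, hru]; simp
    exact (pow_left_inj₀ (norm_nonneg _) hr.le hu.ne').mp h3
  have hc := hs.coeff_zero_eq_prod_roots_of_monic hPm
  have hnorm : ‖P.coeff 0‖ = r ^ p.natDegree := by
    rw [hc, norm_mul, norm_pow, norm_neg, norm_one, one_pow, one_mul]
    have : ‖P.roots.prod‖ = (P.roots.map (fun x => ‖x‖)).prod :=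
      map_multiset_prod (normHom : ℂ →*₀ ℝ) _
    rw [this, Multiset.map_congr rfl hroot]
    simp [← hnd, hs.natDegree_eq_card_roots]
  have hcF : P.coeff 0 ∈ F := by
    rw [hP, Polynomial.coeff_map]; exact (p.coeff 0).2
  obtain ⟨y, hy⟩ := hF _ hcF
  rw [← hy] at hnorm hcF
  rw [Complex.norm_real, Real.norm_eq_abs] at hnorm
  rcases abs_choice y with h | h
  · have : (r : ℂ) ^ p.natDegree = y := by rw [← h, hnorm]; push_cast; rfl
    rw [this]; exact hcF
  · have : (r : ℂ) ^ p.natDegree = -y := by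
      have h' : -y = r ^ p.natDegree := by rw [← h, hnorm]
      exact_mod_cast h'.symm
    rw [this]; exact neg_mem hcF

lemma aux_tower (x : ℂ) (hx : IsIntegral ℚ x) (F : IntermediateField ℚ ℂ)
    (hF : F ≤ IntermediateField.adjoin ℚ {x}) :
    Module.finrank ℚ F * (minpoly F x).natDegree =
      Module.finrank ℚ (IntermediateField.adjoin ℚ {x}) := by
  have hx' : IsIntegral F x := hx.tower_top
  rw [← IntermediateField.adjoin.finrank hx', Module.finrank_mul_finrank]
  have h : (IntermediateField.adjoin F {x}).restrictScalars ℚ =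
      IntermediateField.adjoin ℚ {x} := by
    exact (restrictScalars_adjoin_eq_sup ℚ F {x}).trans (sup_eq_right.mpr hF)
  rw [← h]
  rfl

lemma aux_real (r : ℝ) : ∀ x ∈ IntermediateField.adjoin ℚ {(r : ℂ)}, ∃ y : ℝ, (y : ℂ) = x := by
  intro x hx
  have h : IntermediateField.adjoin ℚ {(r : ℂ)} ≤
      (Complex.ofRealAm.restrictScalars ℚ).fieldRange := by
    rw [IntermediateField.adjoin_le_iff]
    rintro _ rfl
    exact ⟨r, rfl⟩
  obtain ⟨y, hy⟩ := h hx
  exact ⟨y, hy⟩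

lemma aux_sq (u : ℕ) (hu : 0 < u) (c : ℚ) (s : ℝ) (hsu : s ^ u = c)
    (F : IntermediateField ℚ ℂ) (hF : ∀ x ∈ F, ∃ y : ℝ, (y : ℂ) = x) [Normal ℚ F]
    [FiniteDimensional ℚ F] (hs : (s : ℂ) ∈ F) :
    (s : ℂ) ^ 2 ∈ (⊥ : IntermediateField ℚ ℂ) := by
  have : IsGalois ℚ F := ⟨⟩
  have hpw : (⟨s, hs⟩ : F) ^ u = algebraMap ℚ F c := by
    apply Subtype.ext
    have : (s : ℂ) ^ u = ((c : ℝ) : ℂ) := by rw [← hsu]; push_cast; rfl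
    simpa using this
  have key : (⟨s, hs⟩ : F) ^ 2 ∈ (⊥ : IntermediateField ℚ F) := by
    rw [IsGalois.mem_bot_iff_fixed]
    intro σ
    have h1 : (σ ⟨s, hs⟩) ^ u = (⟨s, hs⟩ : F) ^ u := by
      rw [← map_pow, hpw, AlgEquiv.commutes]
    obtain ⟨y, hy⟩ := hF _ (σ ⟨s, hs⟩).2
    have h2 : (y : ℂ) ^ u = (s : ℂ) ^ u := by
      rw [hy]; exact congrArg Subtype.val h1
    have h3 : y ^ u = s ^ u := by exact_mod_cast h2
    have h4 : |y| = |s| := by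
      apply (pow_left_inj₀ (abs_nonneg _) (abs_nonneg _) hu.ne').mp
      rw [← abs_pow, ← abs_pow, h3]
    have h5 : y ^ 2 = s ^ 2 := (sq_eq_sq_iff_abs_eq_abs _ _).mpr h4
    rw [map_pow]
    apply Subtype.ext
    change ((σ ⟨s, hs⟩ : F) : ℂ) ^ 2 = (s : ℂ) ^ 2
    rw [← hy]; exact_mod_cast h5
  obtain ⟨q, hq⟩ := IntermediateField.mem_bot.mp key
  exact IntermediateField.mem_bot.mpr ⟨q, congrArg Subtype.val hq⟩

/-- The maximal subfield of `Q(a^{1/u})` normal over `Q` is `Q` for `u` odd and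
`Q(√a1)` for `u` even. -/
theorem maximal_normal_subfield_of_root (a a1 a2 : ℕ) (ha : 0 < a)
    (hpow : ∀ h, 2 ≤ h → ¬∃ b : ℕ, b ^ h = a)
    (hfact : a = a1 * a2 ^ 2) (hsf : Squarefree a1) (u : ℕ) (hu : 0 < u) :
    (Odd u → ∀ F : IntermediateField ℚ ℂ,
      F ≤ IntermediateField.adjoin ℚ {rootC a u} → Normal ℚ F → F = ⊥) ∧
    (Even u →
      ((Real.sqrt a1 : ℂ) ∈ IntermediateField.adjoin ℚ {rootC a u} ∧
        ∀ F : IntermediateField ℚ ℂ,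
          F ≤ IntermediateField.adjoin ℚ {rootC a u} → Normal ℚ F →
            F ≤ IntermediateField.adjoin ℚ {((Real.sqrt a1 : ℝ) : ℂ)})) := by
  have hex : ∃ r : ℝ, 0 < r ∧ r ^ u = a ∧ rootC a u = (r : ℂ) := by
    refine ⟨(a : ℝ) ^ ((u : ℝ)⁻¹), by positivity, ?_, rfl⟩
    exact Real.rpow_inv_natCast_pow (by positivity) hu.ne'
  obtain ⟨r, hr, hru, hroot⟩ := hex
  rw [hroot]
  have hruC : (r : ℂ) ^ u = a := by exact_mod_cast hru
  have hint : IsIntegral ℚ (r : ℂ) := by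
    refine IsIntegral.of_pow hu ?_
    rw [hruC]
    exact_mod_cast isIntegral_algebraMap (R := ℚ) (A := ℂ) (x := ((a : ℕ) : ℚ))
  have : FiniteDimensional ℚ (IntermediateField.adjoin ℚ {(r : ℂ)}) :=
    IntermediateField.adjoin.finiteDimensional hint
  have hfr : Module.finrank ℚ (IntermediateField.adjoin ℚ {(r : ℂ)}) = u := by
    apply le_antisymm
    · rw [IntermediateField.adjoin.finrank hint]
      have hd : minpoly ℚ (r : ℂ) ∣ Polynomial.X ^ u - Polynomial.C (a : ℚ) := by
        apply minpoly.dvd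
        simp [hruC]
      have := Polynomial.natDegree_le_of_dvd hd (Polynomial.X_pow_sub_C_ne_zero hu _)
      rwa [Polynomial.natDegree_X_pow_sub_C] at this
    · have h1 := aux_pow_mem a u hu r hr hru ⊥ (fun x hx => aux_real r x (bot_le (a := IntermediateField.adjoin ℚ {(r : ℂ)}) hx))
      have h2 := aux_dvd a u hu hpow r hr hru _ h1
      have h3 := aux_tower (r : ℂ) hint ⊥ bot_le
      rw [IntermediateField.finrank_bot, one_mul] at h3
      rw [h3] at h2
      exact Nat.le_of_dvd Module.finrank_pos h2
  have main : ∀ F : IntermediateField ℚ ℂ,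
      F ≤ IntermediateField.adjoin ℚ {(r : ℂ)} → Normal ℚ F →
      ∃ e : ℕ, (r : ℂ) ^ e ∈ F ∧ Module.finrank ℚ F * e = u ∧ u ∣ 2 * e := by
    intro F hF hN
    have hreal : ∀ x ∈ F, ∃ y : ℝ, (y : ℂ) = x := fun x hx => aux_real r x (hF hx)
    have h1 := aux_pow_mem a u hu r hr hru F hreal
    have h2 := aux_tower (r : ℂ) hint F hF
    rw [hfr] at h2
    refine ⟨_, h1, h2, ?_⟩
    set e := (minpoly F (r : ℂ)).natDegree
    have : FiniteDimensional ℚ F :=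
      FiniteDimensional.of_injective (IntermediateField.inclusion hF).toLinearMap
        (IntermediateField.inclusion hF).injective
    have h3 := aux_sq u hu ((a : ℚ) ^ e) (r ^ e)
      (by rw [← pow_mul, mul_comm, pow_mul, hru]; push_cast; rfl) F hreal
      (by push_cast; exact h1)
    apply aux_dvd a u hu hpow r hr hru
    push_cast at h3
    rwa [← pow_mul, mul_comm] at h3
  refine ⟨?_, ?_⟩
  · intro hodd F hF hN
    obtain ⟨e, he, hde, hdv⟩ := main F hF hN
    have h1 : u ∣ e := (Nat.Coprime.dvd_of_dvd_mul_left
      (Nat.Coprime.symm (Nat.coprime_two_left.mpr hodd)) hdv)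
    have hepos : 0 < e := Nat.pos_of_ne_zero (by rintro rfl; omega)
    have h2 : e = u := Nat.dvd_antisymm ⟨_, by rw [← hde, mul_comm]⟩ h1
    rw [h2] at hde
    have : Module.finrank ℚ F = 1 := Nat.eq_of_mul_eq_mul_right hu (by omega)
    exact IntermediateField.finrank_eq_one_iff.mp this
  · rintro ⟨v, hv⟩
    have hv2 : u = v * 2 := by omega
    have hrv : r ^ v = a2 * Real.sqrt a1 := by
      have h1 : (r ^ v) ^ 2 = (a2 * Real.sqrt a1) ^ 2 := by
        rw [← pow_mul, ← hv2, hru, mul_pow, Real.sq_sqrt (by positivity), hfact]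
        push_cast; ring
      exact (pow_left_inj₀ (by positivity) (by positivity) two_ne_zero).mp h1
    have hrvC : (r : ℂ) ^ v = a2 * ((Real.sqrt a1 : ℝ) : ℂ) := by exact_mod_cast hrv
    have ha2 : (a2 : ℂ) ≠ 0 := by
      have : a2 ≠ 0 := by rintro rfl; simp at hfact; omega
      exact_mod_cast this
    have hsq : ((Real.sqrt a1 : ℝ) : ℂ) = (r : ℂ) ^ v / a2 := by
      rw [hrvC]; field_simp
    have hmem : ∀ E : IntermediateField ℚ ℂ, (r : ℂ) ^ v ∈ E → ((Real.sqrt a1 : ℝ) : ℂ) ∈ E := by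
      intro E hE
      rw [hsq]
      exact div_mem hE (_root_.natCast_mem E a2)
    refine ⟨hmem _ (pow_mem (IntermediateField.mem_adjoin_simple_self ℚ _) _), ?_⟩
    intro F hF hN
    obtain ⟨e, he, hde, hdv⟩ := main F hF hN
    have : FiniteDimensional ℚ F :=
      FiniteDimensional.of_injective (IntermediateField.inclusion hF).toLinearMap
        (IntermediateField.inclusion hF).injective
    have hepos : 0 < e := Nat.pos_of_ne_zero (by rintro rfl; omega)
    have hle : Module.finrank ℚ F ≤ 2 := by
      have := Nat.le_of_dvd (by omega) hdv
      rw [← hde] at this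
      exact Nat.le_of_mul_le_mul_right this hepos
    have hpos : 0 < Module.finrank ℚ F := Module.finrank_pos
    have hcase : Module.finrank ℚ F = 1 ∨ Module.finrank ℚ F = 2 := by omega
    rcases hcase with h | h
    · rw [IntermediateField.finrank_eq_one_iff.mp h]; exact bot_le
    · rw [h] at hde
      have hev : e = v := by omega
      rw [hev] at he
      have hsub : IntermediateField.adjoin ℚ {((Real.sqrt a1 : ℝ) : ℂ)} ≤ F := by
        rw [IntermediateField.adjoin_simple_le_iff]; exact hmem F he
      refine (IntermediateField.eq_of_le_of_finrank_le hsub ?_).ge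
      rw [h]
      have : FiniteDimensional ℚ (IntermediateField.adjoin ℚ {((Real.sqrt a1 : ℝ) : ℂ)}) :=
        FiniteDimensional.of_injective (IntermediateField.inclusion hsub).toLinearMap
          (IntermediateField.inclusion hsub).injective
      have hp2 : 0 < Module.finrank ℚ (IntermediateField.adjoin ℚ {((Real.sqrt a1 : ℝ) : ℂ)}) :=
        Module.finrank_pos
      by_contra hlt
      have h1 : Module.finrank ℚ (IntermediateField.adjoin ℚ {((Real.sqrt a1 : ℝ) : ℂ)}) = 1 := by
        omega
      have h2 := IntermediateField.finrank_eq_one_iff.mp h1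
      have h3 : ((Real.sqrt a1 : ℝ) : ℂ) ∈ (⊥ : IntermediateField ℚ ℂ) := by
        rw [← h2]; exact IntermediateField.mem_adjoin_simple_self ℚ _
      have h4 : (r : ℂ) ^ v ∈ (⊥ : IntermediateField ℚ ℂ) := by
        rw [hrvC]; exact mul_mem (_root_.natCast_mem _ a2) h3
      have h5 := Nat.le_of_dvd (by omega) (aux_dvd a u hu hpow r hr hru v h4)
      omega
end

section
/- Let a be a positive integer which is not a perfect h-th power for any h ≥ 2, write a = a1·a2² with a1 squarefree, let u, v be positive integers, and set D_{u,v} = [Q(a^{1/u}, ζ_v) : Q], where a^{1/u} is the real positive u-th root of a. Then: (1) if u is odd, D_{u,v} = u·φ(v); (2) if u is even, D_{u,v} = u·φ(v) or u·φ(v)/2, and the latter holds if and only if one of the following is satisfied: (i) a1 ≡ 1 (mod 4) and a1 | v; (ii) a1 ≡ 2 (mod 4) and 4·a1 | v; (iii) a1 ≡ 3 (mod 4) and 4·a1 | v. -/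
open scoped Classical
open IntermediateField

lemma aux_ratpow {a : ℕ} (ha : 0 < a) (hpow : ∀ h, 2 ≤ h → ¬∃ b : ℕ, b ^ h = a)
    {u m : ℕ} (hu : 0 < u) {r : ℚ} (hr0 : 0 < r) (hr : r ^ u = (a : ℚ) ^ m) : u ∣ m := by
  have ha' : (0 : ℚ) < a := by exact_mod_cast ha
  set g := Nat.gcd u m with hg
  have hgpos : 0 < g := Nat.gcd_pos_of_pos_left _ hu
  obtain ⟨u', hu'⟩ : g ∣ u := Nat.gcd_dvd_left _ _
  have hbez := Nat.gcd_eq_gcd_ab u m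
  set x := Nat.gcdA u m
  set y := Nat.gcdB u m
  set s : ℚ := (a : ℚ) ^ x * r ^ y with hs
  have hspos : 0 < s := by positivity
  have h1 : (a : ℚ) ^ g = s ^ u := by
    rw [hs, mul_pow, ← zpow_natCast, ← zpow_natCast, ← zpow_natCast, ← zpow_mul, ← zpow_mul,
      mul_comm y, zpow_mul r, zpow_natCast r, hr, ← zpow_natCast, ← zpow_mul, ← zpow_add₀ ha'.ne']
    congr 1
    rw [hbez]; ring
  have h2 : (a : ℚ) = s ^ u' := by
    rw [hu', mul_comm, pow_mul] at h1
    exact (pow_left_inj₀ ha'.le (by positivity) hgpos.ne').1 h1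
  have hu'0 : u' ≠ 0 := by rintro rfl; omega
  have h3 : s.den = 1 := by
    have := congrArg Rat.den h2
    rw [Rat.den_natCast, Rat.den_pow] at this
    exact (pow_eq_one_iff.1 this.symm).resolve_right hu'0
  have h4 : s = (s.num.natAbs : ℚ) := by
    have : (s.num : ℚ) = s := Rat.coe_int_num_of_den_eq_one h3
    have hn : 0 ≤ s.num := (Rat.num_pos.2 hspos).le
    conv_lhs => rw [← this]
    have : ((s.num.natAbs : ℤ) : ℚ) = (s.num : ℚ) := by rw [Int.natAbs_of_nonneg hn]
    rw [← this, Int.cast_natCast]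
  have h5 : s.num.natAbs ^ u' = a := by
    rw [h4] at h2
    exact_mod_cast h2.symm
  have : u' = 1 := by
    by_contra hne
    exact hpow u' (by omega) ⟨_, h5⟩
  rw [hu', this, mul_one]
  exact Nat.gcd_dvd_right _ _

lemma zet_prim (m : ℕ) (hm : m ≠ 0) : IsPrimitiveRoot (zet m) m := by
  exact Complex.isPrimitiveRoot_exp m hm

lemma zet_cyc (v : ℕ) [NeZero v] : IsCyclotomicExtension {v} ℚ ℚ⟮zet v⟯ := by
  have hz := zet_prim v (NeZero.ne v)
  have halg : IsAlgebraic ℚ (zet v) := (hz.isIntegral (NeZero.pos v)).tower_top.isAlgebraic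
  change IsCyclotomicExtension {v} ℚ (IntermediateField.adjoin ℚ {zet v}).toSubalgebra
  rw [IntermediateField.adjoin_simple_toSubalgebra_of_isAlgebraic halg]
  exact hz.adjoin_isCyclotomicExtension ℚ

lemma zet_mem {d v : ℕ} (hv : v ≠ 0) (h : d ∣ v) : zet d ∈ ℚ⟮zet v⟯ := by
  obtain ⟨k, rfl⟩ := h
  have hd : d ≠ 0 := left_ne_zero_of_mul hv
  have hk : k ≠ 0 := right_ne_zero_of_mul hv
  have : zet d = zet (d * k) ^ k := by
    unfold zet
    rw [← Complex.exp_nat_mul]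
    congr 1
    have : (k : ℂ) ≠ 0 := by exact_mod_cast hk
    have : (d : ℂ) ≠ 0 := by exact_mod_cast hd
    push_cast
    field_simp
  rw [this]
  exact pow_mem (mem_adjoin_simple_self ℚ _) k

lemma zet_le {d v : ℕ} (hv : v ≠ 0) (h : d ∣ v) : ℚ⟮zet d⟯ ≤ ℚ⟮zet v⟯ := by
  rw [adjoin_simple_le_iff]; exact zet_mem hv h

lemma gauss_prime (p : ℕ) (hp : p.Prime) (hp2 : p ≠ 2) :
    ∃ g ∈ ℚ⟮zet p⟯, g ^ 2 = ((ZMod.χ₄ p : ℤ) : ℂ) * p := by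
  have := Fact.mk hp
  have hring : ringChar (ZMod p) ≠ 2 := by rwa [ZMod.ringChar_zmod_n]
  let χ : MulChar (ZMod p) ℂ := (quadraticChar (ZMod p)).ringHomComp (Int.castRingHom ℂ)
  have hq : χ.IsQuadratic := (quadraticChar_isQuadratic (ZMod p)).comp _
  have h1 : χ ≠ 1 := by
    obtain ⟨a, ha⟩ := quadraticChar_exists_neg_one' hring
    intro h
    have := congrArg (fun f : MulChar (ZMod p) ℂ => f a) h
    simp [χ, ha, MulChar.one_apply] at this
    norm_num at this
  have hz := zet_prim p hp.ne_zero
  have hs := gaussSum_sq h1 hq (AddChar.zmodChar_primitive_of_primitive_root p hz)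
  refine ⟨_, ?_, hs.trans ?_⟩
  · unfold gaussSum
    refine sum_mem fun x _ => mul_mem ?_ ?_
    · simp [χ]
    · rw [AddChar.zmodChar_apply]
      exact pow_mem (mem_adjoin_simple_self ℚ _) _
  · simp only [χ, MulChar.ringHomComp_apply, ZMod.card]
    rw [quadraticChar_neg_one hring, ZMod.card]
    simp

lemma gauss_odd (m : ℕ) (hm : Odd m) : ∃ g ∈ ℚ⟮zet m⟯, g ^ 2 = ((ZMod.χ₄ m : ℤ) : ℂ) * m := by
  induction m using induction_on_primes with
  | zero => simp at hm
  | one => exact ⟨1, one_mem _, by simp⟩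
  | prime_mul p m hp ih =>
    rw [Nat.odd_mul] at hm
    obtain ⟨g, hg, hg2⟩ := ih hm.2
    obtain ⟨f, hf, hf2⟩ := gauss_prime p hp (by rintro rfl; exact absurd hm.1 (by decide))
    have hne : p * m ≠ 0 := mul_ne_zero hp.ne_zero (by rintro rfl; simpa using hm.2)
    refine ⟨f * g, mul_mem (zet_le hne (dvd_mul_right _ _) hf) (zet_le hne (dvd_mul_left _ _) hg), ?_⟩
    rw [mul_pow, hf2, hg2]
    push_cast
    rw [map_mul]
    push_cast
    ring

lemma I_mem : Complex.I ∈ ℚ⟮zet 4⟯ := by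
  have : zet 4 = Complex.I := by
    unfold zet
    refine Eq.trans ?_ Complex.exp_pi_div_two_mul_I
    congr 1; push_cast; ring
  rw [← this]; exact mem_adjoin_simple_self ℚ _

lemma two_mem : ∃ g ∈ ℚ⟮zet 8⟯, g ^ 2 = 2 := by
  have h := zet_prim 8 (by norm_num)
  have h4 : zet 8 ^ 4 = -1 := by
    have h1 : (zet 8 ^ 4 - 1) * (zet 8 ^ 4 + 1) = 0 := by
      have := h.pow_eq_one
      linear_combination this
    have h2 : zet 8 ^ 4 - 1 ≠ 0 := by
      rw [sub_ne_zero]; exact h.pow_ne_one_of_pos_of_lt (by norm_num) (by norm_num)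
    have := (mul_eq_zero.1 h1).resolve_left h2
    linear_combination this
  have hm : zet 8 ∈ ℚ⟮zet 8⟯ := mem_adjoin_simple_self ℚ _
  refine ⟨zet 8 - zet 8 ^ 3, sub_mem hm (pow_mem hm 3), ?_⟩
  linear_combination (-2 + zet 8 ^ 2) * h4

lemma sqrt_mem (a1 v : ℕ) (hv : v ≠ 0) (h : (a1 % 4 = 1 ∧ a1 ∣ v) ∨ (a1 % 4 = 2 ∧ 4 * a1 ∣ v) ∨
          (a1 % 4 = 3 ∧ 4 * a1 ∣ v)) : ∃ s ∈ ℚ⟮zet v⟯, s ^ 2 = (a1 : ℂ) := by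
  have key : ∀ m : ℕ, m % 2 = 1 → 4 * m ∣ v → ∃ s ∈ ℚ⟮zet v⟯, s ^ 2 = (m : ℂ) := by
    intro m hm hd
    obtain ⟨g, hg, hg2⟩ := gauss_odd m (Nat.odd_iff.2 hm)
    have hgv := zet_le hv (Dvd.dvd.trans (dvd_mul_left _ _) hd) hg
    have hI := zet_le hv (Dvd.dvd.trans (dvd_mul_right _ _) hd) I_mem
    have h4 : m % 4 = 1 ∨ m % 4 = 3 := by omega
    rcases h4 with h4 | h4
    · rw [ZMod.χ₄_nat_one_mod_four h4] at hg2
      exact ⟨g, hgv, by simpa using hg2⟩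
    · rw [ZMod.χ₄_nat_three_mod_four h4] at hg2
      refine ⟨Complex.I * g, mul_mem hI hgv, ?_⟩
      rw [mul_pow, hg2, Complex.I_sq]; push_cast; ring
  rcases h with ⟨h4, hd⟩ | ⟨h4, hd⟩ | ⟨h4, hd⟩
  · obtain ⟨g, hg, hg2⟩ := gauss_odd a1 (Nat.odd_iff.2 (by omega))
    rw [ZMod.χ₄_nat_one_mod_four h4] at hg2
    exact ⟨g, zet_le hv hd hg, by simpa using hg2⟩
  · obtain ⟨m, rfl⟩ : 2 ∣ a1 := by omega
    obtain ⟨s, hs, hs2⟩ := key m (by omega) (Dvd.dvd.trans ⟨2, by ring⟩ hd)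
    obtain ⟨t, ht, ht2⟩ := two_mem
    refine ⟨t * s, mul_mem (zet_le hv (Dvd.dvd.trans ⟨m, by ring⟩ hd) ht) hs, ?_⟩
    rw [mul_pow, hs2, ht2]; push_cast; ring
  · exact key a1 (by omega) hd

lemma isSquare_mod {v n q : ℕ} (hv : v ≠ 0) {s : ℂ} (hs : s ∈ ℚ⟮zet v⟯) (hs2 : s ^ 2 = n)
    (hq : q.Prime) (hvq : v ∣ q - 1) : IsSquare (n : ZMod q) := by
  have : Fact q.Prime := ⟨hq⟩
  have : NeZero v := ⟨hv⟩
  have hz := zet_prim v hv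
  have hcyc : IsCyclotomicExtension {v} ℚ ℚ⟮zet v⟯ :=
    zet_cyc v
  set ζ : ℚ⟮zet v⟯ := ⟨zet v, mem_adjoin_simple_self ℚ _⟩ with hζdef
  have hζ : IsPrimitiveRoot ζ v := by
    rw [← IsPrimitiveRoot.coe_submonoidClass_iff]; exact hz
  set t : ℚ⟮zet v⟯ := ⟨s, hs⟩ with ht
  have ht2 : t ^ 2 = (n : ℚ⟮zet v⟯) := by
    apply Subtype.ext; simpa using hs2
  have hint : IsIntegral ℤ t := by
    refine ⟨Polynomial.X ^ 2 - Polynomial.C (n : ℤ), Polynomial.monic_X_pow_sub_C _ two_ne_zero, ?_⟩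
    simp [ht2]
  have hic := IsCyclotomicExtension.Rat.isIntegralClosure_adjoin_singleton hζ
  obtain ⟨y, hy⟩ := hic.isIntegral_iff.1 hint
  obtain ⟨P, hP⟩ := (Algebra.adjoin_singleton_eq_range_aeval ℤ ζ ▸ y.2 :
    (y : ℚ⟮zet v⟯) ∈ (Polynomial.aeval (R := ℤ) ζ).range)
  have hPt : Polynomial.aeval ζ P = t := hP.trans hy
  have hdvd : Polynomial.cyclotomic v ℤ ∣ P ^ 2 - Polynomial.C (n : ℤ) := by
    rw [Polynomial.cyclotomic_eq_minpoly hζ (Nat.pos_of_ne_zero hv)]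
    apply minpoly.isIntegrallyClosed_dvd (hζ.isIntegral (Nat.pos_of_ne_zero hv))
    simp [hPt, ht2]
  obtain ⟨g, hg⟩ := IsCyclic.exists_ofOrder_eq_natCard (α := (ZMod q)ˣ)
  rw [Nat.card_eq_fintype_card, ZMod.card_units] at hg
  have hprim : IsPrimitiveRoot ((g : ZMod q)) (q - 1) := by
    rw [IsPrimitiveRoot.coe_units_iff, ← hg]; exact IsPrimitiveRoot.orderOf g
  obtain ⟨k, hk⟩ := hvq
  have hq1 : 0 < q - 1 := by have := hq.two_le; omega
  have hr : IsPrimitiveRoot ((g : ZMod q) ^ k) v := hprim.pow hq1 (by rw [hk, mul_comm])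
  have hroot := hr.isRoot_cyclotomic (Nat.pos_of_ne_zero hv)
  obtain ⟨R, hR⟩ := hdvd
  have := congrArg (fun f => Polynomial.eval₂ (Int.castRingHom (ZMod q)) ((g : ZMod q) ^ k) f) hR
  simp only [Polynomial.eval₂_mul, Polynomial.eval₂_sub, Polynomial.eval₂_pow,
    Polynomial.eval₂_C] at this
  rw [← Polynomial.eval_map _ _ (p := Polynomial.cyclotomic v ℤ), Polynomial.map_cyclotomic,
    hroot.eq_zero, zero_mul, sub_eq_zero] at this
  refine ⟨Polynomial.eval₂ (Int.castRingHom (ZMod q)) ((g : ZMod q) ^ k) P, ?_⟩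
  rw [← sq, this]; simp

open NumberTheorySymbols in
lemma jac_ne {v n k : ℕ} (hv : v ≠ 0) (hn : n ≠ 0) {s : ℂ} (hs : s ∈ ℚ⟮zet v⟯) (hs2 : s ^ 2 = n)
    (hk : Odd k) (hkv : k ≡ 1 [MOD v]) : J(n | k) ≠ -1 := by
  intro hJ
  have h1 : Nat.Coprime k n := by
    by_contra h
    have : J(n | k) = 0 := by
      rw [jacobiSym.eq_zero_iff]
      refine ⟨by rintro rfl; simp at hk, ?_⟩
      rw [Int.gcd_natCast_natCast]
      rwa [Nat.coprime_comm] at h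
    omega
  have h2 : Nat.Coprime k v := by
    have := hkv.gcd_eq
    rwa [Nat.gcd_one_left] at this
  have h4 : Nat.Coprime k 4 := by
    exact (Nat.Coprime.pow_right 2 (Nat.coprime_two_right.2 hk) : Nat.Coprime k (2 ^ 2))
  have hc : Nat.Coprime k (4 * n * v) := (h4.mul_right h1).mul_right h2
  obtain ⟨q, hqk, hq, hmod⟩ := Nat.forall_exists_prime_gt_and_modEq 2
    (q := 4 * n * v) (a := k) (by positivity) hc
  have : Fact q.Prime := ⟨hq⟩
  have hqodd : Odd q := hq.odd_of_ne_two (by omega)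
  have e1 : q % (4 * n) = k % (4 * n) := hmod.of_mul_right _
  have e2 : q ≡ 1 [MOD v] := (hmod.of_mul_left _).trans hkv
  have hJq : J(n | q) = -1 := by
    rw [jacobiSym.mod_right' n hqodd, e1, ← jacobiSym.mod_right' n hk, hJ]
  have hns := ZMod.nonsquare_of_jacobiSym_eq_neg_one hJq
  apply hns
  have := isSquare_mod hv hs hs2 hq ((Nat.modEq_iff_dvd' hq.one_le).1 e2.symm)
  simpa using this

open NumberTheorySymbols in
lemma prime_dvd_of_mem {v n p : ℕ} (hv : v ≠ 0) (hn : Squarefree n) {s : ℂ} (hs : s ∈ ℚ⟮zet v⟯)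
    (hs2 : s ^ 2 = n) (hp : p.Prime) (hp2 : p ≠ 2) (hpn : p ∣ n) : p ∣ v := by
  by_contra hpv
  have : Fact p.Prime := ⟨hp⟩
  obtain ⟨m, rfl⟩ := hpn
  have hm0 : m ≠ 0 := by rintro rfl; simp at hn
  have hpm : ¬ p ∣ m := by
    intro h
    exact hp.not_isUnit (hn p (mul_dvd_mul_left p h))
  obtain ⟨x, hx⟩ := FiniteField.exists_nonsquare (F := ZMod p) (by rwa [ZMod.ringChar_zmod_n])
  have hcop : Nat.Coprime (4 * m * v) p := by
    rw [Nat.coprime_comm, hp.coprime_iff_not_dvd, hp.dvd_mul, hp.dvd_mul]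
    have : ¬ p ∣ 4 := fun h => hp2 ((Nat.prime_dvd_prime_iff_eq hp Nat.prime_two).1
      (hp.dvd_of_dvd_pow (n := 2) (by simpa using h)))
    tauto
  obtain ⟨k, hk1, hk2⟩ := Nat.chineseRemainder hcop 1 x.val
  have hk4 : k % 4 = 1 := ((hk1.of_mul_right _).of_mul_right m : k ≡ 1 [MOD 4])
  have hkodd : Odd k := Nat.odd_iff.2 (by omega)
  have hkm : k ≡ 1 [MOD 4 * m] := hk1.of_mul_right _
  have hpodd : Odd p := hp.odd_of_ne_two hp2
  refine jac_ne hv (Nat.mul_ne_zero hp.ne_zero hm0) hs hs2 hkodd (hk1.of_mul_left _) ?_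
  push_cast
  rw [jacobiSym.mul_left]
  have e1 : J(m | k) = 1 := by
    rw [jacobiSym.mod_right' m hkodd, hkm, Nat.mod_eq_of_lt (by omega), jacobiSym.one_right]
  have e2 : J(p | k) = -1 := by
    rw [jacobiSym.quadratic_reciprocity_one_mod_four' hpodd hk4,
      ZMod.nonsquare_iff_jacobiSym_eq_neg_one]
    have : ((k : ℤ) : ZMod p) = x := by
      have h := (ZMod.natCast_eq_natCast_iff _ _ _).2 hk2
      rw [ZMod.natCast_zmod_val] at h
      simpa using h
    rwa [this]
  rw [e1, e2]; norm_num

open NumberTheorySymbols in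
lemma cond_of_mem {v a1 : ℕ} (hv : v ≠ 0) (hsf : Squarefree a1) {s : ℂ} (hs : s ∈ ℚ⟮zet v⟯)
    (hs2 : s ^ 2 = a1) : (a1 % 4 = 1 ∧ a1 ∣ v) ∨ (a1 % 4 = 2 ∧ 4 * a1 ∣ v) ∨
          (a1 % 4 = 3 ∧ 4 * a1 ∣ v) := by
  have ha0 : a1 ≠ 0 := hsf.ne_zero
  have hodd : ∀ m : ℕ, m % 2 = 1 → m ∣ a1 → m ∣ v := by
    intro m hm hd
    have hmsf := hsf.squarefree_of_dvd hd
    rw [← Nat.prod_primeFactors_of_squarefree hmsf]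
    refine (Finset.prod_dvd_prod_of_subset _ _ _ ?_).trans (Nat.prod_primeFactors_dvd v)
    intro p hp
    have hpp := Nat.prime_of_mem_primeFactors hp
    have hpd := Nat.dvd_of_mem_primeFactors hp
    refine Nat.mem_primeFactors.2 ⟨hpp, prime_dvd_of_mem hv hsf hs hs2 hpp ?_ (hpd.trans hd), hv⟩
    rintro rfl; omega
  have h40 : a1 % 4 ≠ 0 := by
    intro h
    have := hsf 2 (by omega)
    simp at this
  have hcases : a1 % 4 = 1 ∨ a1 % 4 = 2 ∨ a1 % 4 = 3 := by omega
  rcases hcases with h | h | h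
  · exact Or.inl ⟨h, hodd a1 (by omega) dvd_rfl⟩
  · refine Or.inr (Or.inl ⟨h, ?_⟩)
    obtain ⟨m, rfl⟩ : 2 ∣ a1 := by omega
    have hm1 : m % 2 = 1 := by omega
    have hmv : m ∣ v := hodd m hm1 (dvd_mul_left _ _)
    have h8 : 8 ∣ v := by
      by_contra h8
      obtain ⟨w, hw1, hw2, hw3⟩ : ∃ w, w % 2 = 1 ∧ v ∣ 4 * w ∧ m ∣ w := by
        obtain ⟨e, w, hw, rfl⟩ := Nat.exists_eq_two_pow_mul_odd hv
        refine ⟨w, Nat.odd_iff.1 hw, ?_, ?_⟩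
        · have he : e ≤ 2 := by
            by_contra he
            exact h8 (Dvd.dvd.mul_right (pow_dvd_pow 2 (show 3 ≤ e by omega)) _)
          exact mul_dvd_mul_right (pow_dvd_pow 2 he) w
        · exact (Nat.Coprime.pow_right e (Nat.coprime_two_right.2 (Nat.odd_iff.2 hm1))).dvd_of_dvd_mul_left hmv
      have hkodd : Odd (1 + 4 * w) := Nat.odd_iff.2 (by omega)
      refine jac_ne hv ha0 hs hs2 hkodd
        ((Nat.modEq_iff_dvd' (by omega)).2 (by simpa using hw2)).symm ?_
      push_cast
      rw [jacobiSym.mul_left]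
      have e2 : J(2 | 1 + 4 * w) = -1 := by
        rw [jacobiSym.at_two hkodd, ZMod.χ₈_nat_eq_if_mod_eight]
        rw [if_neg (by omega), if_neg (by omega)]
      have e1 : J(m | 1 + 4 * w) = 1 := by
        rw [jacobiSym.quadratic_reciprocity_one_mod_four' (Nat.odd_iff.2 hm1) (by omega)]
        rw [jacobiSym.mod_left' (a₂ := 1), jacobiSym.one_left]
        obtain ⟨c, rfl⟩ := hw3
        push_cast
        rw [show (1 + 4 * ((m : ℤ) * c)) = 1 + m * (4 * c) by ring]
        simp
      rw [e1, e2]; norm_num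
    have : Nat.Coprime 8 m := by
      exact (Nat.Coprime.pow_left 3 (Nat.coprime_two_left.2 (Nat.odd_iff.2 hm1)) : Nat.Coprime (2 ^ 3) m)
    have := this.mul_dvd_of_dvd_of_dvd h8 hmv
    rwa [show 4 * (2 * m) = 8 * m by ring]
  · refine Or.inr (Or.inr ⟨h, ?_⟩)
    have hm1 : a1 % 2 = 1 := by omega
    have hmv : a1 ∣ v := hodd a1 hm1 dvd_rfl
    have h8 : 4 ∣ v := by
      by_contra h8
      obtain ⟨w, hw1, hw2, hw3⟩ : ∃ w, w % 2 = 1 ∧ v ∣ 2 * w ∧ a1 ∣ w := by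
        obtain ⟨e, w, hw, rfl⟩ := Nat.exists_eq_two_pow_mul_odd hv
        refine ⟨w, Nat.odd_iff.1 hw, ?_, ?_⟩
        · have he : e ≤ 1 := by
            by_contra he
            exact h8 (Dvd.dvd.mul_right (pow_dvd_pow 2 (show 2 ≤ e by omega)) _)
          exact mul_dvd_mul_right (pow_dvd_pow 2 he) w
        · exact (Nat.Coprime.pow_right e (Nat.coprime_two_right.2 (Nat.odd_iff.2 hm1))).dvd_of_dvd_mul_left hmv
      have hkodd : Odd (1 + 2 * w) := Nat.odd_iff.2 (by omega)
      refine jac_ne hv ha0 hs hs2 hkodd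
        ((Nat.modEq_iff_dvd' (by omega)).2 (by simpa using hw2)).symm ?_
      rw [jacobiSym.quadratic_reciprocity_three_mod_four h (by omega)]
      rw [jacobiSym.mod_left' (a₂ := 1), jacobiSym.one_left]
      obtain ⟨c, rfl⟩ := hw3
      push_cast
      rw [show (1 + 2 * ((a1 : ℤ) * c)) = 1 + a1 * (2 * c) by ring]
      simp
    have : Nat.Coprime 4 a1 := by
      exact (Nat.Coprime.pow_left 2 (Nat.coprime_two_left.2 (Nat.odd_iff.2 hm1)) : Nat.Coprime (2 ^ 2) a1)
    exact this.mul_dvd_of_dvd_of_dvd h8 hmv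

lemma rootC_pow (a u : ℕ) (hu : u ≠ 0) : rootC a u ^ u = a := by
  unfold rootC
  rw [← Complex.ofReal_pow, Real.rpow_inv_natCast_pow (Nat.cast_nonneg a) hu]
  simp

/-- the key structural fact -/
lemma key_deg {a u v : ℕ} (ha : 0 < a) (hpow : ∀ h, 2 ≤ h → ¬∃ b : ℕ, b ^ h = a)
    (hu : 0 < u) (hv : v ≠ 0) (e : ℕ) (he : e = (minpoly ℚ⟮zet v⟯ (rootC a u)).natDegree) :
    e = u ∨ (2 * e = u ∧ ∃ s ∈ ℚ⟮zet v⟯, s ^ 2 = (a : ℂ)) := by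
  set K := ℚ⟮zet v⟯ with hK
  set α := rootC a u with hα
  have hαu : α ^ u = a := rootC_pow a u hu.ne'
  have : NeZero v := ⟨hv⟩
  have hcyc : IsCyclotomicExtension {v} ℚ K :=
    zet_cyc v
  have hfin : FiniteDimensional ℚ K := IsCyclotomicExtension.finiteDimensional {v} ℚ K
  have hgal : IsGalois ℚ K := IsCyclotomicExtension.isGalois {v} ℚ K
  have hcomm : IsMulCommutative (K ≃ₐ[ℚ] K) := IsCyclotomicExtension.isMulCommutative {v} ℚ K
  have hint : IsIntegral K α := by
    refine ⟨Polynomial.X ^ u - Polynomial.C (a : K), Polynomial.monic_X_pow_sub_C _ hu.ne', ?_⟩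
    simp [hαu]
  set p := minpoly K α with hp
  have hpm : p.Monic := minpoly.monic hint
  have hep : 0 < e := he ▸ minpoly.natDegree_pos hint
  have hdvd : p ∣ Polynomial.X ^ u - Polynomial.C (a : K) := by
    apply minpoly.dvd; simp [hαu]
  have heu : e ≤ u := by
    have := Polynomial.natDegree_le_of_dvd hdvd (Polynomial.monic_X_pow_sub_C _ hu.ne').ne_zero
    rwa [Polynomial.natDegree_X_pow_sub_C, ← he] at this
  -- complex conjugation on K
  let conjQ : ℂ ≃ₐ[ℚ] ℂ := Complex.conjAe.restrictScalars ℚ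
  let τ : K ≃ₐ[ℚ] K := conjQ.restrictNormal K
  have hτ : ∀ x : K, ((τ x : K) : ℂ) = (starRingEnd ℂ) (x : ℂ) := fun x =>
    AlgEquiv.restrictNormal_commutes conjQ K x
  have hmap : p.map (τ : K →+* K) = p := by
    symm
    apply Polynomial.eq_of_dvd_of_natDegree_le_of_leadingCoeff
    · apply minpoly.dvd
      rw [Polynomial.aeval_def, Polynomial.eval₂_map]
      have h1 : (algebraMap K ℂ).comp (τ : K →+* K) = (starRingEnd ℂ).comp (algebraMap K ℂ) := by
        ext x; exact hτ x
      have h2 : α = (starRingEnd ℂ) α := by rw [hα]; unfold rootC; rw [Complex.conj_ofReal]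
      rw [h1, h2, ← Polynomial.hom_eval₂, ← Polynomial.aeval_def, minpoly.aeval, map_zero]
    · rw [Polynomial.natDegree_map]
    · rw [hpm.leadingCoeff, (hpm.map _).leadingCoeff]
  set c : K := p.coeff 0 with hc
  have hcτ : τ c = c := by
    conv_rhs => rw [hc, ← hmap, Polynomial.coeff_map]
    rfl
  have hαnorm : ‖α‖ ^ u = a := by
    rw [← norm_pow, hαu]; simp
  have hcn : ‖(c : ℂ)‖ = ‖α‖ ^ e := by
    set P := p.map (algebraMap K ℂ) with hP
    have hPm : P.Monic := hpm.map _
    have hs : P.Splits := IsAlgClosed.splits P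
    have h0 : (c : ℂ) = P.coeff 0 := by rw [hP, Polynomial.coeff_map]; rfl
    rw [h0, hs.coeff_zero_eq_prod_roots_of_monic hPm, norm_mul, norm_pow, norm_neg, norm_one,
      one_pow, one_mul]
    have hroot : ∀ z ∈ P.roots, ‖z‖ = ‖α‖ := by
      intro z hz
      have hz0 : Polynomial.aeval z p = 0 := by
        have := (Polynomial.mem_roots hPm.ne_zero).1 hz
        rwa [Polynomial.IsRoot, hP, Polynomial.eval_map_algebraMap] at this
      have hzu : z ^ u = a := by
        obtain ⟨q, hq⟩ := hdvd
        have := congrArg (Polynomial.aeval z) hq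
        rw [map_mul, hz0, zero_mul] at this
        simpa [sub_eq_zero] using this
      refine (pow_left_inj₀ (norm_nonneg _) (norm_nonneg _) hu.ne').1 ?_
      rw [hαnorm, ← norm_pow, hzu]; simp
    have hcard : P.roots.card = e := by
      rw [← hs.natDegree_eq_card_roots, hP, Polynomial.natDegree_map, he]
    have hmp : ‖P.roots.prod‖ = (P.roots.map (fun z => ‖z‖)).prod :=
      map_multiset_prod (normHom : ℂ →*₀ ℝ) _
    rw [hmp, Multiset.map_congr rfl hroot, Multiset.map_const', Multiset.prod_replicate, hcard]
  have hcu : ‖(c : ℂ)‖ ^ u = (a : ℝ) ^ e := by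
    rw [hcn, ← pow_mul, mul_comm, pow_mul, hαnorm]
  -- real elements
  have hreal : ∀ x : K, τ x = x → ∃ r : ℝ, (x : ℂ) = r := by
    intro x hx
    refine ⟨(x : ℂ).re, ?_⟩
    exact ((Complex.conj_eq_iff_re).1 (by rw [← hτ, hx])).symm
  obtain ⟨r, hr⟩ := hreal c hcτ
  have hrabs : |r| ^ u = (a : ℝ) ^ e := by
    rw [← hcu, hr, Complex.norm_real, Real.norm_eq_abs]
  have hr2u : (r ^ 2) ^ u = (a : ℝ) ^ (2 * e) := by
    rw [← sq_abs, ← pow_mul, mul_comm, pow_mul, hrabs, ← pow_mul, mul_comm]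
  have hc2u : (c ^ 2) ^ u = (a : K) ^ (2 * e) := by
    apply Subtype.ext
    push_cast
    rw [hr]; exact_mod_cast hr2u
  have hfix : ∀ σ : K ≃ₐ[ℚ] K, σ (c ^ 2) = c ^ 2 := by
    intro σ
    have hσ : τ (σ c) = σ c := by
      have : τ * σ = σ * τ := hcomm.is_comm.comm τ σ
      have := congrArg (fun f : K ≃ₐ[ℚ] K => f c) this
      simpa [AlgEquiv.mul_apply, hcτ] using this
    obtain ⟨t, ht⟩ := hreal _ hσ
    have h1 : (σ c ^ 2) ^ u = (a : K) ^ (2 * e) := by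
      have := congrArg σ hc2u
      simpa using this
    have h2 : (t ^ 2) ^ u = (r ^ 2) ^ u := by
      rw [hr2u]
      have := congrArg (fun x : K => (x : ℂ)) h1
      push_cast at this
      rw [ht] at this
      exact_mod_cast this
    have h3 : t ^ 2 = r ^ 2 := (pow_left_inj₀ (sq_nonneg _) (sq_nonneg _) hu.ne').1 h2
    apply Subtype.ext
    rw [map_pow]
    push_cast
    rw [ht, hr]; exact_mod_cast h3
  obtain ⟨q, hq⟩ := (IsGalois.mem_range_algebraMap_iff_fixed (c ^ 2)).2 hfix
  have hqr : (q : ℝ) = r ^ 2 := by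
    have := congrArg (fun x : K => (x : ℂ)) hq
    have h' : ((q : ℚ) : ℂ) = (r : ℂ) ^ 2 := by
      rw [← hr]; simpa using this
    exact_mod_cast h'
  have hqu : q ^ u = (a : ℚ) ^ (2 * e) := by
    rw [← hqr] at hr2u; exact_mod_cast hr2u
  have hq0 : 0 < q := by
    have h0 : 0 ≤ q := by
      have : (0 : ℝ) ≤ q := by rw [hqr]; positivity
      exact_mod_cast this
    rcases h0.eq_or_lt with h | h
    · rw [← h, zero_pow hu.ne'] at hqu
      have : (0 : ℚ) < (a : ℚ) ^ (2 * e) := by positivity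
      linarith
    · exact h
  obtain ⟨k, hk⟩ := aux_ratpow ha hpow hu hq0 hqu
  have hk0 : k ≠ 0 := by rintro rfl; omega
  have hk2 : k ≤ 2 := by
    by_contra h
    have : u * 3 ≤ u * k := Nat.mul_le_mul_left _ (by omega)
    omega
  have : k = 1 ∨ k = 2 := by omega
  rcases this with rfl | rfl
  · right
    refine ⟨by omega, c, c.2, ?_⟩
    have h1 : q = a := by
      rw [hk, mul_one] at hqu
      exact (pow_left_inj₀ hq0.le (by positivity) hu.ne').1 hqu
    rw [hr]
    rw [h1] at hqr
    have : r ^ 2 = (a : ℝ) := by rw [← hqr]; simp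
    exact_mod_cast this
  · left; omega

lemma deg_le {a u v : ℕ} (hu : 0 < u) (hue : Even u) {s : ℂ} (hs : s ∈ ℚ⟮zet v⟯)
    (hs2 : s ^ 2 = a) : 2 * (minpoly ℚ⟮zet v⟯ (rootC a u)).natDegree ≤ u := by
  obtain ⟨w, rfl⟩ := hue
  have hw : w ≠ 0 := by omega
  have h := rootC_pow a (w + w) hu.ne'
  have hex : ∃ t : ℚ⟮zet v⟯, rootC a (w + w) ^ w = t := by
    have : (rootC a (w + w) ^ w) ^ 2 = s ^ 2 := by rw [hs2, ← h, ← pow_mul]; ring_nf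
    rcases sq_eq_sq_iff_eq_or_eq_neg.1 this with h | h
    · exact ⟨⟨s, hs⟩, h⟩
    · exact ⟨⟨-s, neg_mem hs⟩, h⟩
  obtain ⟨t, ht⟩ := hex
  have := Polynomial.natDegree_le_of_dvd (minpoly.dvd ℚ⟮zet v⟯ (rootC a (w + w))
    (p := Polynomial.X ^ w - Polynomial.C t) (by simp [ht]))
    (Polynomial.monic_X_pow_sub_C _ hw).ne_zero
  rw [Polynomial.natDegree_X_pow_sub_C] at this
  omega

lemma deg_formula (a u v : ℕ) (hu : 0 < u) (hv : v ≠ 0) :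
    Module.finrank ℚ (IntermediateField.adjoin ℚ {rootC a u, zet v}) =
      Nat.totient v * (minpoly ℚ⟮zet v⟯ (rootC a u)).natDegree := by
  have : NeZero v := ⟨hv⟩
  have hcyc : IsCyclotomicExtension {v} ℚ ℚ⟮zet v⟯ :=
    zet_cyc v
  have hint : IsIntegral ℚ⟮zet v⟯ (rootC a u) := by
    refine ⟨Polynomial.X ^ u - Polynomial.C (a : ℚ⟮zet v⟯),
      Polynomial.monic_X_pow_sub_C _ hu.ne', ?_⟩
    simp [rootC_pow a u hu.ne']
  have h1 : (IntermediateField.adjoin ℚ {rootC a u, zet v}) =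
      (IntermediateField.adjoin ℚ⟮zet v⟯ {rootC a u}).restrictScalars ℚ := by
    refine Eq.trans ?_ (adjoin_adjoin_left ℚ {zet v} {rootC a u}).symm
    congr 1
    ext x; simp [or_comm]
  rw [h1, ← IntermediateField.adjoin.finrank hint, ← IsCyclotomicExtension.finrank (n := v) ℚ⟮zet v⟯
    (Polynomial.cyclotomic.irreducible_rat (Nat.pos_of_ne_zero hv))]
  exact (Module.finrank_mul_finrank ℚ ℚ⟮zet v⟯
    (IntermediateField.adjoin ℚ⟮zet v⟯ {rootC a u})).symm

theorem degree_root_adjoin_zeta (a a1 a2 : ℕ) (ha : 0 < a)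
    (hpow : ∀ h, 2 ≤ h → ¬∃ b : ℕ, b ^ h = a)
    (hfact : a = a1 * a2 ^ 2) (hsf : Squarefree a1)
    (u v : ℕ) (hu : 0 < u) (hv : 0 < v)
    (D : ℕ)
    (hD : D = Module.finrank ℚ (IntermediateField.adjoin ℚ {rootC a u, zet v})) :
    (Odd u → D = u * Nat.totient v) ∧
    (Even u →
      (D = u * Nat.totient v ∨ 2 * D = u * Nat.totient v) ∧
      (2 * D = u * Nat.totient v ↔
        (a1 % 4 = 1 ∧ a1 ∣ v) ∨ (a1 % 4 = 2 ∧ 4 * a1 ∣ v) ∨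
          (a1 % 4 = 3 ∧ 4 * a1 ∣ v))) := by
  have hv0 := hv.ne'
  rw [deg_formula a u v hu hv0] at hD
  set e := (minpoly ℚ⟮zet v⟯ (rootC a u)).natDegree with he
  have hφ : 0 < Nat.totient v := Nat.totient_pos.2 hv
  have hkey := key_deg ha hpow hu hv0 e he
  have ha2 : a2 ≠ 0 := by rintro rfl; simp at hfact; omega
  have ha2C : (a2 : ℂ) ≠ 0 := by exact_mod_cast ha2
  refine ⟨fun hodd => ?_, fun heven => ⟨?_, ?_, ?_⟩⟩
  · rcases hkey with h | ⟨h, -⟩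
    · rw [hD, h, mul_comm]
    · rw [← h] at hodd
      exact absurd hodd (by simp)
  · rcases hkey with h | ⟨h, -⟩
    · left; rw [hD, h, mul_comm]
    · right; rw [hD, ← h]; ring
  · intro h2
    rcases hkey with h | ⟨h, s, hs, hs2⟩
    · rw [hD, h] at h2
      have := Nat.mul_pos hφ hu
      rw [mul_comm u] at h2
      omega
    · refine cond_of_mem (s := s / a2) hv0 hsf (div_mem hs (_root_.natCast_mem _ _)) ?_
      rw [div_pow, hs2, hfact]
      push_cast
      field_simp
  · intro hc
    obtain ⟨s, hs, hs2⟩ := sqrt_mem a1 v hv0 hc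
    have hle := deg_le (a := a) (s := s * a2) hu heven (mul_mem hs (_root_.natCast_mem _ _)) (by
      rw [mul_pow, hs2, hfact]; push_cast; ring)
    rcases hkey with h | ⟨h, -⟩
    · omega
    · rw [hD, ← h]; ring
end
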